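/- Let Y₁,…,Y_m be i.i.d. standard normal random variables. Then for every 1 ≤ j ≤ m and every 1 ≤ p ≤ 2: √(π/2)·(m + 1 − j)/(m + 1) ≤ E|Y_(j)| and E|Y_(j)|^p ≤ C_p · Σ_{ℓ=j}^m 1/ℓ ≤ C_p·(1/j + ln(m/j)), where C_p := p·sup_{0 < t < ∞} t^{p−1} ∫_t^∞ e^{(t² − s²)/2} ds; moreover C_p ≤ p·(π/2)^{1 − p/2}. -/

import Mathlib

open MeasureTheory ProbabilityTheory Real

/-- The canonical probability space of `m` i.i.d. standard Gaussian random variables. -/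
noncomputable def stdGaussianPi (m : ℕ) : Measure (Fin m → ℝ) :=
  Measure.pi fun _ => gaussianReal 0 1

/-- `absOrd y j = |Y_(j+1)|`: the `(j+1)`-st largest among `|y 0|, …, |y (m-1)|`. -/
noncomputable def absOrd {m : ℕ} (y : Fin m → ℝ) (j : Fin m) : ℝ :=
  |y (Tuple.sort (fun i => -|y i|) j)|

/-- `C_p := p · sup_{0 < t < ∞} t^{p−1} ∫_t^∞ e^{(t²−s²)/2} ds`. -/
noncomputable def Cconst (p : ℝ) : ℝ :=
  p * sSup {u : ℝ | ∃ t : ℝ, 0 < t ∧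
    u = t ^ (p - 1) * ∫ s in Set.Ioi t, Real.exp ((t ^ 2 - s ^ 2) / 2)}

section GaussianTail

open Set Filter Topology

/-- The unnormalised Gaussian tail integral. -/
noncomputable def gaussTailIntegral (t : ℝ) : ℝ :=
  ∫ s in Ioi t, Real.exp (-s ^ 2 / 2)

theorem integrable_exp_neg_sq_div_two : Integrable fun s : ℝ => Real.exp (-s ^ 2 / 2) := by
  refine (integrable_exp_neg_mul_sq (b := 1 / 2) (by norm_num)).congr (ae_of_all _ fun s => ?_)
  ring_nf

theorem gaussTailIntegral_nonneg (t : ℝ) : 0 ≤ gaussTailIntegral t :=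
  setIntegral_nonneg measurableSet_Ioi fun _ _ => (Real.exp_pos _).le

theorem gaussTailIntegral_zero : gaussTailIntegral 0 = √(π / 2) := by
  have h := integral_gaussian_Ioi (1 / 2)
  have h2 : √(π / (1 / 2)) / 2 = √(π / 2) := by
    rw [show π / (1 / 2) = 2 ^ 2 * (π / 2) by ring, Real.sqrt_mul (by positivity),
      Real.sqrt_sq (by norm_num)]
    ring
  rw [← h2, ← h, gaussTailIntegral]
  congr 1; ext s; congr 1; ring

theorem gaussTailIntegral_eq_sub (t : ℝ) :
    gaussTailIntegral t = gaussTailIntegral 0 - ∫ s in (0 : ℝ)..t, Real.exp (-s ^ 2 / 2) := by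
  have := intervalIntegral.integral_Ioi_sub_Ioi'
    (integrable_exp_neg_sq_div_two.integrableOn (s := Ioi 0))
    (integrable_exp_neg_sq_div_two.integrableOn (s := Ioi t))
  simp only [gaussTailIntegral]
  linarith

theorem hasDerivAt_gaussTailIntegral (t : ℝ) :
    HasDerivAt gaussTailIntegral (-Real.exp (-t ^ 2 / 2)) t := by
  have hc : Continuous fun s : ℝ => Real.exp (-s ^ 2 / 2) := by fun_prop
  have h := (intervalIntegral.integral_hasDerivAt_right (hc.intervalIntegrable 0 t)
    (hc.stronglyMeasurableAtFilter _ _) hc.continuousAt).const_sub (gaussTailIntegral 0)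
  rwa [← funext gaussTailIntegral_eq_sub] at h

theorem tendsto_gaussTailIntegral : Tendsto gaussTailIntegral atTop (𝓝 0) := by
  have h := (intervalIntegral_tendsto_integral_Ioi 0
    (integrable_exp_neg_sq_div_two.integrableOn (s := Ioi 0)) tendsto_id).const_sub
      (gaussTailIntegral 0)
  rw [funext gaussTailIntegral_eq_sub]
  simpa [gaussTailIntegral] using h

theorem gaussTailIntegral_le_sqrt_mul_exp {t : ℝ} (ht : 0 ≤ t) :
    gaussTailIntegral t ≤ √(π / 2) * Real.exp (-t ^ 2 / 2) := by
  have hshift : gaussTailIntegral t = ∫ r in Ioi (0 : ℝ), Real.exp (-(r + t) ^ 2 / 2) := by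
    have h := (measurePreserving_add_right volume t).setIntegral_preimage_emb
      (measurableEmbedding_addRight t) (fun s => Real.exp (-s ^ 2 / 2)) (Ioi t)
    rw [gaussTailIntegral, ← h]
    simp
  rw [hshift, ← gaussTailIntegral_zero, gaussTailIntegral, ← integral_mul_const]
  refine setIntegral_mono_on (integrable_exp_neg_sq_div_two.comp_add_right t).integrableOn
    (integrable_exp_neg_sq_div_two.integrableOn.mul_const _) measurableSet_Ioi fun r hr => ?_
  rw [← Real.exp_add]
  gcongr
  nlinarith [mul_nonneg (le_of_lt hr) ht]

theorem mul_gaussTailIntegral_le_exp {t : ℝ} (ht : 0 ≤ t) :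
    t * gaussTailIntegral t ≤ Real.exp (-t ^ 2 / 2) := by
  have hd : ∀ x ∈ Ici t,
      HasDerivAt (fun s : ℝ => -Real.exp (-s ^ 2 / 2)) (x * Real.exp (-x ^ 2 / 2)) x := by
    intro x _
    have h := (((hasDerivAt_pow 2 x).neg.div_const 2).exp).neg
    convert! h using 1
    simp; ring
  have hpos : ∀ x ∈ Ioi t, 0 ≤ x * Real.exp (-x ^ 2 / 2) := fun x hx =>
    mul_nonneg (ht.trans (le_of_lt hx)) (Real.exp_pos _).le
  have hlim : Tendsto (fun s : ℝ => -Real.exp (-s ^ 2 / 2)) atTop (𝓝 0) := by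
    rw [← neg_zero]
    refine (Real.tendsto_exp_atBot.comp ?_).neg
    refine Tendsto.atBot_div_const (by norm_num) ?_
    exact tendsto_neg_atTop_atBot.comp (tendsto_pow_atTop two_ne_zero)
  have hint := integrableOn_Ioi_deriv_of_nonneg' hd hpos hlim
  have heq := integral_Ioi_of_hasDerivAt_of_nonneg' hd hpos hlim
  rw [zero_sub, neg_neg] at heq
  rw [← heq, gaussTailIntegral, ← integral_const_mul]
  refine setIntegral_mono_on (integrable_exp_neg_sq_div_two.integrableOn.const_mul _) hint
    measurableSet_Ioi fun s hs => ?_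
  gcongr
  exact le_of_lt hs

theorem millsRatio_eq (t : ℝ) :
    ∫ s in Ioi t, Real.exp ((t ^ 2 - s ^ 2) / 2) =
      Real.exp (t ^ 2 / 2) * gaussTailIntegral t := by
  rw [gaussTailIntegral, ← integral_const_mul]
  congr 1; ext s
  rw [← Real.exp_add]; congr 1; ring

theorem millsRatio_nonneg (t : ℝ) : 0 ≤ ∫ s in Ioi t, Real.exp ((t ^ 2 - s ^ 2) / 2) :=
  setIntegral_nonneg measurableSet_Ioi fun _ _ => (Real.exp_pos _).le

theorem rpow_mul_millsRatio_le {p t : ℝ} (hp1 : 1 ≤ p) (hp2 : p ≤ 2) (ht : 0 < t) :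
    t ^ (p - 1) * ∫ s in Ioi t, Real.exp ((t ^ 2 - s ^ 2) / 2) ≤ (π / 2) ^ (1 - p / 2) := by
  set M := ∫ s in Ioi t, Real.exp ((t ^ 2 - s ^ 2) / 2) with hM
  have hM0 : 0 ≤ M := millsRatio_nonneg t
  have hexp : Real.exp (t ^ 2 / 2) * Real.exp (-t ^ 2 / 2) = 1 := by
    rw [← Real.exp_add, ← Real.exp_zero]; congr 1; ring
  have hM1 : M ≤ √(π / 2) := by
    rw [hM, millsRatio_eq]
    calc _ ≤ Real.exp (t ^ 2 / 2) * (√(π / 2) * Real.exp (-t ^ 2 / 2)) := by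
          gcongr; exact gaussTailIntegral_le_sqrt_mul_exp ht.le
      _ = √(π / 2) := by linear_combination √(π / 2) * hexp
  have hM2 : t * M ≤ 1 := by
    rw [hM, millsRatio_eq, ← hexp, mul_left_comm]
    gcongr; exact mul_gaussTailIntegral_le_exp ht.le
  have hsplit : M = M ^ (p - 1) * M ^ (2 - p) := by
    rw [← Real.rpow_add_of_nonneg hM0 (by linarith) (by linarith)]
    norm_num
  calc t ^ (p - 1) * M = (t * M) ^ (p - 1) * M ^ (2 - p) := by
        rw [Real.mul_rpow ht.le hM0, mul_assoc, ← hsplit]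
    _ ≤ 1 * √(π / 2) ^ (2 - p) := by
        gcongr
        · exact Real.rpow_le_one (by positivity) hM2 (by linarith)
    _ = (π / 2) ^ (1 - p / 2) := by
        rw [one_mul, Real.sqrt_eq_rpow, ← Real.rpow_mul (by positivity)]
        congr 1; ring

theorem Cconst_le {p : ℝ} (hp1 : 1 ≤ p) (hp2 : p ≤ 2) :
    Cconst p ≤ p * (π / 2) ^ (1 - p / 2) := by
  refine mul_le_mul_of_nonneg_left (csSup_le ⟨_, 1, one_pos, rfl⟩ ?_) (by linarith)
  rintro _ ⟨t, ht, rfl⟩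
  exact rpow_mul_millsRatio_le hp1 hp2 ht

theorem mul_rpow_mul_millsRatio_le_Cconst {p t : ℝ} (hp1 : 1 ≤ p) (hp2 : p ≤ 2) (ht : 0 < t) :
    p * (t ^ (p - 1) * ∫ s in Ioi t, Real.exp ((t ^ 2 - s ^ 2) / 2)) ≤ Cconst p := by
  refine mul_le_mul_of_nonneg_left (le_csSup ⟨(π / 2) ^ (1 - p / 2), ?_⟩ ⟨t, ht, rfl⟩)
    (by linarith)
  rintro _ ⟨t, ht, rfl⟩
  exact rpow_mul_millsRatio_le hp1 hp2 ht

theorem Cconst_nonneg {p : ℝ} (hp1 : 1 ≤ p) (hp2 : p ≤ 2) : 0 ≤ Cconst p :=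
  le_trans (mul_nonneg (by linarith) (mul_nonneg (by positivity) (millsRatio_nonneg 1)))
    (mul_rpow_mul_millsRatio_le_Cconst hp1 hp2 one_pos)

/-- The two-sided tail probability `P(|Y| ≥ t)` of a standard normal variable `Y`. -/
noncomputable def absGaussTail (t : ℝ) : ℝ :=
  √(2 / π) * gaussTailIntegral t

theorem sqrt_two_div_pi_mul : √(2 / π) * √(π / 2) = 1 := by
  rw [← Real.sqrt_mul (by positivity), div_mul_div_comm, mul_comm π 2, div_self (by positivity),
    Real.sqrt_one]

theorem absGaussTail_zero : absGaussTail 0 = 1 := by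
  rw [absGaussTail, gaussTailIntegral_zero, sqrt_two_div_pi_mul]

theorem absGaussTail_nonneg (t : ℝ) : 0 ≤ absGaussTail t :=
  mul_nonneg (Real.sqrt_nonneg _) (gaussTailIntegral_nonneg t)

theorem absGaussTail_le_one {t : ℝ} (ht : 0 ≤ t) : absGaussTail t ≤ 1 := by
  rw [absGaussTail, ← sqrt_two_div_pi_mul]
  gcongr
  refine (gaussTailIntegral_le_sqrt_mul_exp ht).trans (mul_le_of_le_one_right (by positivity) ?_)
  rw [Real.exp_le_one_iff]
  nlinarith [sq_nonneg t]

theorem hasDerivAt_absGaussTail (t : ℝ) :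
    HasDerivAt absGaussTail (-(√(2 / π) * Real.exp (-t ^ 2 / 2))) t := by
  have h := (hasDerivAt_gaussTailIntegral t).const_mul √(2 / π)
  rwa [mul_neg] at h

theorem continuous_absGaussTail : Continuous absGaussTail :=
  continuous_iff_continuousAt.2 fun t => (hasDerivAt_absGaussTail t).continuousAt

theorem tendsto_absGaussTail : Tendsto absGaussTail atTop (𝓝 0) := by
  have h := tendsto_gaussTailIntegral.const_mul √(2 / π)
  rwa [mul_zero] at h

theorem gaussianReal_le_abs {t : ℝ} (ht : 0 < t) :
    gaussianReal 0 1 {y | t ≤ |y|} = ENNReal.ofReal (absGaussTail t) := by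
  have hset : {y : ℝ | t ≤ |y|} = Ici t ∪ (fun x => -x) ⁻¹' Ici t := by
    ext y; simp only [mem_ofPred_eq, le_abs, mem_union, mem_Ici, mem_preimage]
  have hdisj : Disjoint (Ici t) ((fun x : ℝ => -x) ⁻¹' Ici t) := by
    rw [Set.disjoint_left]
    intro y hy hy'
    simp only [mem_Ici, mem_preimage] at hy hy'
    linarith
  have hneg : gaussianReal 0 1 ((fun x : ℝ => -x) ⁻¹' Ici t) = gaussianReal 0 1 (Ici t) := by
    rw [← Measure.map_apply measurable_neg measurableSet_Ici, gaussianReal_map_neg, neg_zero]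
  have hone : gaussianReal 0 1 (Ici t) =
      ENNReal.ofReal ((√(2 * π))⁻¹ * gaussTailIntegral t) := by
    rw [gaussianReal_apply_eq_integral _ one_ne_zero, integral_Ici_eq_integral_Ioi,
      gaussTailIntegral, ← integral_const_mul]
    simp [gaussianPDFReal]
  have hpos : 0 ≤ (√(2 * π))⁻¹ * gaussTailIntegral t :=
    mul_nonneg (by positivity) (gaussTailIntegral_nonneg t)
  have hsqrt : √(2 / π) = 2 * (√(2 * π))⁻¹ := by
    rw [show 2 / π = 2 ^ 2 * (2 * π)⁻¹ by field_simp, Real.sqrt_mul (by positivity),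
      Real.sqrt_sq (by norm_num), Real.sqrt_inv]
  rw [hset, measure_union hdisj (measurable_neg measurableSet_Ici), hneg, hone,
    ← ENNReal.ofReal_add hpos hpos, absGaussTail, hsqrt]
  congr 1; ring

theorem integral_pow_mul_one_sub_pow (a b : ℕ) :
    ∫ x in (0 : ℝ)..1, x ^ a * (1 - x) ^ b =
      (a.factorial * b.factorial : ℝ) / (a + b + 1).factorial := by
  induction b generalizing a with
  | zero =>
    simp [Nat.factorial_succ]
    field_simp
  | succ b ih =>
    have hd : ∀ x ∈ uIcc (0 : ℝ) 1, HasDerivAt (fun x : ℝ => x ^ (a + 1) * (1 - x) ^ (b + 1))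
        ((a + 1) * (x ^ a * (1 - x) ^ (b + 1)) - (b + 1) * (x ^ (a + 1) * (1 - x) ^ b)) x := by
      intro x _
      have h := (hasDerivAt_pow (a + 1) x).mul (((hasDerivAt_id x).const_sub 1).pow (b + 1))
      convert! h using 1
      simp; ring
    have h := intervalIntegral.integral_eq_sub_of_hasDerivAt hd
      (Continuous.intervalIntegrable (by fun_prop) _ _)
    rw [intervalIntegral.integral_sub (Continuous.intervalIntegrable (by fun_prop) _ _)
      (Continuous.intervalIntegrable (by fun_prop) _ _), intervalIntegral.integral_const_mul,
      intervalIntegral.integral_const_mul, ih] at h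
    have hidx : a + 1 + b + 1 = a + (b + 1) + 1 := by ring
    rw [hidx] at h
    have ha : (a + 1 : ℝ) ≠ 0 := by positivity
    apply mul_left_cancel₀ ha
    have h' := sub_eq_zero.1 (h.trans (by simp))
    rw [h', Nat.factorial_succ a, Nat.factorial_succ b]
    push_cast
    ring

/-- Substituting the tail probability into a beta integral. -/
theorem lintegral_absGaussTail_pow_mul (a b : ℕ) :
    ∫⁻ t in Ioi (0 : ℝ), ENNReal.ofReal (absGaussTail t ^ a * (1 - absGaussTail t) ^ b *
      (√(2 / π) * Real.exp (-t ^ 2 / 2))) =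
      ENNReal.ofReal ((a.factorial * b.factorial : ℝ) / (a + b + 1).factorial) := by
  have hc : Continuous fun x : ℝ => x ^ a * (1 - x) ^ b := by fun_prop
  set F : ℝ → ℝ := fun u => ∫ x in u..1, x ^ a * (1 - x) ^ b with hF
  have hdF : ∀ u, HasDerivAt F (-(u ^ a * (1 - u) ^ b)) u := fun u =>
    intervalIntegral.integral_hasDerivAt_left (hc.intervalIntegrable _ _)
      (hc.stronglyMeasurableAtFilter _ _) hc.continuousAt
  have hd : ∀ t ∈ Ici (0 : ℝ), HasDerivAt (fun t => F (absGaussTail t))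
      (absGaussTail t ^ a * (1 - absGaussTail t) ^ b * (√(2 / π) * Real.exp (-t ^ 2 / 2))) t := by
    intro t _
    have h := (hdF (absGaussTail t)).comp t (hasDerivAt_absGaussTail t)
    rw [neg_mul_neg] at h
    exact h
  have hpos : ∀ t ∈ Ioi (0 : ℝ), 0 ≤
      absGaussTail t ^ a * (1 - absGaussTail t) ^ b * (√(2 / π) * Real.exp (-t ^ 2 / 2)) := by
    intro t ht
    have := absGaussTail_nonneg t
    have := sub_nonneg.2 (absGaussTail_le_one (le_of_lt ht))
    positivity
  have hlim : Tendsto (fun t => F (absGaussTail t)) atTop (𝓝 (F 0)) :=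
    (hdF 0).continuousAt.tendsto.comp tendsto_absGaussTail
  rw [← ofReal_integral_eq_lintegral_ofReal (integrableOn_Ioi_deriv_of_nonneg' hd hpos hlim)
    ((ae_restrict_mem measurableSet_Ioi).mono hpos),
    integral_Ioi_of_hasDerivAt_of_nonneg' hd hpos hlim, absGaussTail_zero]
  simp only [hF, intervalIntegral.integral_same, sub_zero, integral_pow_mul_one_sub_pow]

end GaussianTail

section OrderStatistics

open Set Filter Topology

theorem le_absOrd_iff {m : ℕ} (y : Fin m → ℝ) (j : Fin m) (t : ℝ) :
    t ≤ absOrd y j ↔ (j : ℕ) < (Finset.univ.filter fun i => t ≤ |y i|).card := by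
  set σ := Tuple.sort (fun i => -|y i|) with hσ
  have hmono : Antitone fun k => |y (σ k)| := fun a b hab =>
    neg_le_neg_iff.1 (Tuple.monotone_sort (fun i => -|y i|) hab)
  have hcard : (Finset.univ.filter fun i => t ≤ |y i|).card =
      (Finset.univ.filter fun k => t ≤ |y (σ k)|).card := by
    conv_rhs => rw [← Finset.card_map σ.toEmbedding]
    congr 1
    ext i
    simp only [Finset.mem_filter, Finset.mem_univ, true_and, Finset.mem_map_equiv,
      Equiv.apply_symm_apply]
  rw [hcard]
  exact (Tuple.lt_card_ge_iff_apply_ge_of_antitone hmono).symm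

/-- The binomial tail: the probability that more than `j` of `m` independent samples fall in `A`. -/
theorem measure_pi_lt_card_filter {m : ℕ} (j : ℕ) (P : Measure ℝ) [IsProbabilityMeasure P]
    {A : Set ℝ} [DecidablePred (· ∈ A)] (hA : MeasurableSet A) {u : ℝ} (hu0 : 0 ≤ u) (hu1 : u ≤ 1)
    (hP : P A = ENNReal.ofReal u) :
    Measure.pi (fun _ : Fin m => P) {y | j < (Finset.univ.filter fun i => y i ∈ A).card} =
      ∑ k ∈ Finset.Icc (j + 1) m,
        ENNReal.ofReal ((m.choose k : ℝ) * (u ^ k * (1 - u) ^ (m - k))) := by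
  classical
  have hPc : P Aᶜ = ENNReal.ofReal (1 - u) := by
    rw [measure_compl hA (measure_ne_top _ _), hP, measure_univ, ENNReal.ofReal_sub _ hu0,
      ENNReal.ofReal_one]
  let B : Finset (Fin m) → Fin m → Set ℝ := fun S i => if i ∈ S then A else Aᶜ
  have hmemB : ∀ S (y : Fin m → ℝ), y ∈ Set.pi univ (B S) ↔
      (Finset.univ.filter fun i => y i ∈ A) = S := by
    intro S y
    simp only [Set.mem_pi, mem_univ, true_imp_iff, Finset.ext_iff, Finset.mem_filter,
      Finset.mem_univ, true_and, B]
    refine forall_congr' fun i => ?_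
    by_cases hi : i ∈ S <;> simp [hi]
  have hset : {y : Fin m → ℝ | j < (Finset.univ.filter fun i => y i ∈ A).card} =
      ⋃ S ∈ (Finset.univ : Finset (Fin m)).powerset.filter (fun S => j < S.card),
        Set.pi univ (B S) := by
    ext y
    simp [hmemB]
  have hmeasB : ∀ S, Measure.pi (fun _ : Fin m => P) (Set.pi univ (B S)) =
      ENNReal.ofReal (u ^ S.card * (1 - u) ^ (m - S.card)) := by
    intro S
    rw [Measure.pi_pi]
    simp only [B, apply_ite P, hP, hPc]
    rw [Finset.prod_ite, Finset.prod_const, Finset.prod_const, Finset.filter_mem_eq_inter,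
      Finset.univ_inter, Finset.filter_not, Finset.filter_mem_eq_inter, Finset.univ_inter,
      Finset.card_univ_sdiff, Fintype.card_fin, ENNReal.ofReal_mul (by positivity),
      ENNReal.ofReal_pow hu0, ENNReal.ofReal_pow (by linarith)]
  rw [hset, measure_biUnion_finset]
  · simp only [hmeasB]
    rw [Finset.sum_filter, Finset.sum_powerset_apply_card
      (fun k => if j < k then ENNReal.ofReal (u ^ k * (1 - u) ^ (m - k)) else 0)]
    simp only [Finset.card_univ, Fintype.card_fin, smul_ite, smul_zero]
    rw [← Finset.sum_filter]
    refine Finset.sum_congr ?_ fun k _ => ?_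
    · ext k; simp; omega
    · rw [ENNReal.ofReal_mul (Nat.cast_nonneg _), ENNReal.ofReal_natCast, nsmul_eq_mul]
  · intro S _ S' _ hSS'
    rw [Function.onFun, Set.disjoint_left]
    intro y hy hy'
    exact hSS' (((hmemB S y).1 hy).symm.trans ((hmemB S' y).1 hy'))
  · intro S _
    refine MeasurableSet.univ_pi fun i => ?_
    by_cases hi : i ∈ S <;> simp [B, hi, hA]

instance (m : ℕ) : IsProbabilityMeasure (stdGaussianPi m) := by
  unfold stdGaussianPi; infer_instance

theorem stdGaussianPi_le_absOrd {m : ℕ} (j : Fin m) {t : ℝ} (ht : 0 < t) :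
    stdGaussianPi m {y | t ≤ absOrd y j} =
      ∑ k ∈ Finset.Icc ((j : ℕ) + 1) m, ENNReal.ofReal
        ((m.choose k : ℝ) * (absGaussTail t ^ k * (1 - absGaussTail t) ^ (m - k))) := by
  classical
  have hA : MeasurableSet {y : ℝ | t ≤ |y|} := measurableSet_le measurable_const measurable_norm
  rw [← measure_pi_lt_card_filter j (gaussianReal 0 1) hA (absGaussTail_nonneg t)
    (absGaussTail_le_one ht.le) (gaussianReal_le_abs ht), stdGaussianPi]
  congr 1
  ext y
  simp only [mem_ofPred_eq, le_absOrd_iff]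

theorem absOrd_nonneg {m : ℕ} (y : Fin m → ℝ) (j : Fin m) : 0 ≤ absOrd y j := abs_nonneg _

theorem measurable_absOrd {m : ℕ} (j : Fin m) : Measurable fun y : Fin m → ℝ => absOrd y j := by
  refine measurable_of_Ici fun t => ?_
  have hset : (fun y : Fin m → ℝ => absOrd y j) ⁻¹' Ici t =
      ⋃ S ∈ (Finset.univ : Finset (Finset (Fin m))).filter (fun S => (j : ℕ) < S.card),
        ⋂ i ∈ S, {y : Fin m → ℝ | t ≤ |y i|} := by
    ext y
    simp only [mem_preimage, mem_Ici, le_absOrd_iff, mem_iUnion, mem_iInter, mem_ofPred_eq,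
      Finset.mem_filter, Finset.mem_univ, true_and, exists_prop]
    refine ⟨fun h => ⟨_, h, fun i hi => (Finset.mem_filter.1 hi).2⟩, ?_⟩
    rintro ⟨S, hS, hi⟩
    exact hS.trans_le (Finset.card_le_card fun i hiS => by simpa using hi i hiS)
  rw [hset]
  refine Finset.measurableSet_biUnion _ fun S _ => Finset.measurableSet_biInter _ fun i _ => ?_
  exact measurableSet_le measurable_const (measurable_pi_apply i).norm

theorem lintegral_absOrd_rpow {m : ℕ} (j : Fin m) {p : ℝ} (hp : 1 ≤ p) :
    ∫⁻ y, ENNReal.ofReal (absOrd y j ^ p) ∂stdGaussianPi m =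
      ∑ k ∈ Finset.Icc ((j : ℕ) + 1) m, ∫⁻ t in Ioi (0 : ℝ), ENNReal.ofReal ((m.choose k : ℝ) *
        (absGaussTail t ^ k * (1 - absGaussTail t) ^ (m - k) * (p * t ^ (p - 1)))) := by
  have hmeas := continuous_absGaussTail.measurable
  rw [lintegral_rpow_eq_lintegral_meas_le_mul _ (ae_of_all _ fun y => absOrd_nonneg y j)
    (measurable_absOrd j).aemeasurable (by linarith), ← lintegral_const_mul' _ _ (by simp),
    ← lintegral_finsetSum _ (fun k _ => by fun_prop)]
  refine setLIntegral_congr_fun measurableSet_Ioi fun t ht => ?_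
  have ht : 0 < t := ht
  have h1 := absGaussTail_nonneg t
  have h2 := sub_nonneg.2 (absGaussTail_le_one ht.le)
  simp only [stdGaussianPi_le_absOrd j ht]
  rw [Finset.sum_mul, Finset.mul_sum]
  refine Finset.sum_congr rfl fun k _ => ?_
  rw [← ENNReal.ofReal_mul (by positivity), ← ENNReal.ofReal_mul (by linarith)]
  congr 1; ring

theorem choose_mul_factorial_div {m k : ℕ} (hk : k ≤ m) :
    (m.choose k : ℝ) * ((k.factorial * (m - k).factorial : ℝ) / (k + (m - k) + 1).factorial) =
      1 / (m + 1) := by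
  have h : (m.choose k * k.factorial * (m - k).factorial : ℝ) = m.factorial := by
    exact_mod_cast Nat.choose_mul_factorial_mul_factorial hk
  rw [Nat.add_sub_cancel' hk, Nat.factorial_succ, ← mul_div_assoc, ← mul_assoc, h]
  push_cast
  have := Nat.factorial_ne_zero m
  field_simp

theorem choose_succ_mul_factorial_div {m k : ℕ} (hk : k + 1 ≤ m) :
    (m.choose (k + 1) : ℝ) *
      ((k.factorial * (m - (k + 1)).factorial : ℝ) / (k + (m - (k + 1)) + 1).factorial) =
        1 / ((k + 1 : ℕ) : ℝ) := by
  have h : (m.choose (k + 1) * (k + 1).factorial * (m - (k + 1)).factorial : ℝ) = m.factorial := by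
    exact_mod_cast Nat.choose_mul_factorial_mul_factorial hk
  rw [show k + (m - (k + 1)) + 1 = m by omega, ← h, Nat.factorial_succ]
  have h1 : (m.choose (k + 1) : ℝ) ≠ 0 := by exact_mod_cast (Nat.choose_pos hk).ne'
  have := Nat.factorial_ne_zero k
  have := Nat.factorial_ne_zero (m - (k + 1))
  push_cast
  field_simp

theorem lintegral_absOrd_rpow_le {m : ℕ} (j : Fin m) {p : ℝ} (hp1 : 1 ≤ p) (hp2 : p ≤ 2) :
    ∫⁻ y, ENNReal.ofReal (absOrd y j ^ p) ∂stdGaussianPi m ≤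
      ENNReal.ofReal (Cconst p * ∑ ℓ ∈ Finset.Icc ((j : ℕ) + 1) m, (1 : ℝ) / ℓ) := by
  have hC := Cconst_nonneg hp1 hp2
  rw [lintegral_absOrd_rpow j hp1, Finset.mul_sum,
    ENNReal.ofReal_sum_of_nonneg (fun k _ => by positivity)]
  refine Finset.sum_le_sum fun k hk => ?_
  rw [Finset.mem_Icc] at hk
  obtain ⟨k, rfl⟩ : ∃ l, k = l + 1 := ⟨k - 1, by omega⟩
  rw [← choose_succ_mul_factorial_div hk.2, ← mul_assoc, ENNReal.ofReal_mul (by positivity),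
    ← lintegral_absGaussTail_pow_mul, ← lintegral_const_mul' _ _ (by simp)]
  refine setLIntegral_mono' measurableSet_Ioi fun t ht => ?_
  rw [← ENNReal.ofReal_mul (by positivity)]
  refine ENNReal.ofReal_le_ofReal ?_
  have ht : 0 < t := ht
  have h1 := absGaussTail_nonneg t
  have h2 := sub_nonneg.2 (absGaussTail_le_one ht.le)
  have hkey := mul_rpow_mul_millsRatio_le_Cconst hp1 hp2 ht
  rw [millsRatio_eq] at hkey
  have hexp : Real.exp (t ^ 2 / 2) * Real.exp (-t ^ 2 / 2) = 1 := by
    rw [← Real.exp_add, ← Real.exp_zero]; congr 1; ring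
  have hbound : absGaussTail t * (p * t ^ (p - 1)) ≤
      Cconst p * (√(2 / π) * Real.exp (-t ^ 2 / 2)) := by
    calc _ = p * (t ^ (p - 1) * (Real.exp (t ^ 2 / 2) * gaussTailIntegral t)) *
          (√(2 / π) * Real.exp (-t ^ 2 / 2)) := by
          rw [absGaussTail]
          linear_combination -(√(2 / π) * gaussTailIntegral t * (p * t ^ (p - 1))) * hexp
      _ ≤ _ := by gcongr
  calc _ = (m.choose (k + 1) * (absGaussTail t ^ k * (1 - absGaussTail t) ^ (m - (k + 1)))) *
        (absGaussTail t * (p * t ^ (p - 1))) := by ring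
    _ ≤ (m.choose (k + 1) * (absGaussTail t ^ k * (1 - absGaussTail t) ^ (m - (k + 1)))) *
        (Cconst p * (√(2 / π) * Real.exp (-t ^ 2 / 2))) := by gcongr
    _ = _ := by ring

theorem le_lintegral_absOrd {m : ℕ} (j : Fin m) :
    ENNReal.ofReal (√(π / 2) * (((m : ℝ) + 1 - ((j : ℕ) + 1)) / ((m : ℝ) + 1))) ≤
      ∫⁻ y, ENNReal.ofReal (absOrd y j) ∂stdGaussianPi m := by
  have hsum : √(π / 2) * (((m : ℝ) + 1 - ((j : ℕ) + 1)) / ((m : ℝ) + 1)) =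
      ∑ k ∈ Finset.Icc ((j : ℕ) + 1) m, √(π / 2) * (1 / ((m : ℝ) + 1)) := by
    rw [Finset.sum_const, Nat.card_Icc, nsmul_eq_mul, Nat.cast_sub (by omega)]
    push_cast; ring
  have hmom := lintegral_absOrd_rpow j (p := 1) le_rfl
  simp only [Real.rpow_one] at hmom
  rw [hmom, hsum, ENNReal.ofReal_sum_of_nonneg (fun k _ => by positivity)]
  refine Finset.sum_le_sum fun k hk => ?_
  rw [Finset.mem_Icc] at hk
  rw [← choose_mul_factorial_div hk.2, ← mul_assoc, ENNReal.ofReal_mul (by positivity),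
    ← lintegral_absGaussTail_pow_mul, ← lintegral_const_mul' _ _ (by simp)]
  refine setLIntegral_mono' measurableSet_Ioi fun t ht => ?_
  rw [← ENNReal.ofReal_mul (by positivity)]
  refine ENNReal.ofReal_le_ofReal ?_
  have ht : 0 < t := ht
  have h1 := absGaussTail_nonneg t
  have h2 := sub_nonneg.2 (absGaussTail_le_one ht.le)
  have hexp : Real.exp (-t ^ 2 / 2) ≤ 1 := by
    rw [Real.exp_le_one_iff]
    nlinarith [sq_nonneg t]
  calc _ = (m.choose k * (absGaussTail t ^ k * (1 - absGaussTail t) ^ (m - k))) *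
        (√(2 / π) * √(π / 2) * Real.exp (-t ^ 2 / 2)) := by ring
    _ ≤ (m.choose k * (absGaussTail t ^ k * (1 - absGaussTail t) ^ (m - k))) * 1 := by
        rw [sqrt_two_div_pi_mul, one_mul]
        gcongr
    _ = _ := by simp

theorem sum_Icc_one_div_le {a m : ℕ} (ha : 1 ≤ a) (ham : a ≤ m) :
    ∑ ℓ ∈ Finset.Icc a m, (1 : ℝ) / ℓ ≤ 1 / a + Real.log ((m : ℝ) / a) := by
  induction m, ham using Nat.le_induction with
  | base =>
    have : (a : ℝ) ≠ 0 := by positivity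
    simp [div_self this]
  | succ m ham ih =>
    have ha' : (0 : ℝ) < a := by positivity
    have hm' : (0 : ℝ) < m := by exact_mod_cast ha.trans ham
    have h := Real.one_sub_inv_le_log_of_pos (x := ((m : ℝ) + 1) / m) (by positivity)
    rw [Real.log_div (by positivity) hm'.ne'] at h
    have he : 1 - (((m : ℝ) + 1) / m)⁻¹ = 1 / (m + 1) := by field_simp; ring
    rw [he] at h
    rw [Finset.sum_Icc_succ_top (by omega), Real.log_div (by positivity) ha'.ne']
    rw [Real.log_div hm'.ne' ha'.ne'] at ih
    push_cast
    linarith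

end OrderStatistics

theorem orderStat_moment_bounds (m : ℕ) (j : Fin m) (p : ℝ) (hp1 : 1 ≤ p) (hp2 : p ≤ 2) :
    Real.sqrt (π / 2) * (((m : ℝ) + 1 - ((j : ℕ) + 1)) / ((m : ℝ) + 1)) ≤
        (∫ y, absOrd y j ∂(stdGaussianPi m)) ∧
      (∫ y, absOrd y j ^ p ∂(stdGaussianPi m)) ≤
        Cconst p * ∑ ℓ ∈ Finset.Icc ((j : ℕ) + 1) m, (1 : ℝ) / ℓ ∧
      Cconst p * ∑ ℓ ∈ Finset.Icc ((j : ℕ) + 1) m, (1 : ℝ) / ℓ ≤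
        Cconst p * (1 / ((j : ℕ) + 1) + Real.log ((m : ℝ) / ((j : ℕ) + 1))) ∧
      Cconst p ≤ p * (π / 2) ^ (1 - p / 2) := by
  have hC : ∀ {q : ℝ}, 1 ≤ q → q ≤ 2 →
      0 ≤ Cconst q * ∑ ℓ ∈ Finset.Icc ((j : ℕ) + 1) m, (1 : ℝ) / ℓ := fun h1 h2 =>
    mul_nonneg (Cconst_nonneg h1 h2) (Finset.sum_nonneg fun _ _ => by positivity)
  refine ⟨?_, ?_, ?_, Cconst_le hp1 hp2⟩
  · have hfin := lintegral_absOrd_rpow_le j (p := 1) le_rfl one_le_two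
    simp only [Real.rpow_one] at hfin
    rw [integral_eq_lintegral_of_nonneg_ae (ae_of_all _ fun y => absOrd_nonneg y j)
      (measurable_absOrd j).aestronglyMeasurable,
      ← ENNReal.ofReal_le_iff_le_toReal (ne_top_of_le_ne_top ENNReal.ofReal_ne_top hfin)]
    exact le_lintegral_absOrd j
  · rw [integral_eq_lintegral_of_nonneg_ae
      (ae_of_all _ fun y => Real.rpow_nonneg (absOrd_nonneg y j) p)
      ((measurable_absOrd j).pow_const p).aestronglyMeasurable]
    exact ENNReal.toReal_le_of_le_ofReal (hC hp1 hp2) (lintegral_absOrd_rpow_le j hp1 hp2)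
  · refine mul_le_mul_of_nonneg_left ?_ (Cconst_nonneg hp1 hp2)
    exact_mod_cast sum_Icc_one_div_le (a := (j : ℕ) + 1) (by omega) j.isLt
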